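/- arXiv:1205.4994 — 3 statements merged into one kernel-verified Lean document; each statement's English description precedes it below -/
import Mathlib

section
/- Let v be even, n = v/2, let k be even with n ≥ k ≥ 4, and let h = k/2. If there exists a resolvable (n, h, 2) covering design with p parallel classes where p ≤ 5, then C(v, k, 4, 6) ≤ 2·C(v/2, k, 4) + p·v²/k². -/
/-- `(X, Bs)` is a `(|X|, k, t, m)` cover: `Bs` is a collection of `k`-subsets of `X` such that
every `m`-subset of `X` intersects at least one block of `Bs` in at least `t` points. -/
def IsCover {α : Type*} [DecidableEq α] (X : Finset α) (Bs : Finset (Finset α))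
    (k t m : ℕ) : Prop :=
  (∀ B ∈ Bs, B ⊆ X ∧ B.card = k) ∧
  ∀ M ⊆ X, M.card = m → ∃ B ∈ Bs, t ≤ (M ∩ B).card

/-- The cover number `C(v,k,t,m)`: the minimum number of blocks of a `(v,k,t,m)` cover.
The covering number `C(v,k,t)` is `C(v,k,t,t)`. -/
noncomputable def coverNumber (v k t m : ℕ) : ℕ :=
  sInf { b | ∃ Bs : Finset (Finset (Fin v)),
    IsCover Finset.univ Bs k t m ∧ Bs.card = b }

open Finset

/-- The minimum defining a covering number is attained once some cover exists. -/
theorem exists_cover_card_eq {n k t : ℕ} (htk : t ≤ k) (hkn : k ≤ n) :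
    ∃ C : Finset (Finset (Fin n)), IsCover univ C k t t ∧ C.card = coverNumber n k t t := by
  refine Nat.sInf_mem (s := { b | ∃ Bs : Finset (Finset (Fin n)),
    IsCover univ Bs k t t ∧ Bs.card = b }) ⟨_, powersetCard k univ, ⟨?_, ?_⟩, rfl⟩
  · intro B hB
    exact mem_powersetCard.1 hB
  · intro M _ hM
    obtain ⟨B, hMB, hB⟩ := exists_superset_card_eq (s := M) (n := k) (by omega) (by simpa using hkn)
    refine ⟨B, mem_powersetCard.2 ⟨subset_univ _, hB⟩, ?_⟩
    rw [inter_eq_left.2 hMB, hM]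

/-- A block of a `(v, k, t)` cover meets every set with at least `t` points in `t` points. -/
theorem IsCover.exists_le_card_inter {α : Type*} [DecidableEq α] {X : Finset α}
    {C : Finset (Finset α)} {k t : ℕ} (hC : IsCover X C k t t) {A : Finset α} (hAX : A ⊆ X)
    (hA : t ≤ A.card) : ∃ B ∈ C, t ≤ (A ∩ B).card := by
  obtain ⟨M, hMA, hM⟩ := exists_subset_card_eq hA
  obtain ⟨B, hB, h⟩ := hC.2 M (hMA.trans hAX) hM
  exact ⟨B, hB, h.trans (card_le_card (inter_subset_inter_right hMA))⟩

/-- A pair of distinct points lies in a block of any `(v, k, 2)` cover. -/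
theorem IsCover.exists_mem_mem {α : Type*} [DecidableEq α] {X : Finset α}
    {C : Finset (Finset α)} {k : ℕ} (hC : IsCover X C k 2 2) {a b : α} (ha : a ∈ X) (hb : b ∈ X)
    (hab : a ≠ b) : ∃ B ∈ C, a ∈ B ∧ b ∈ B := by
  obtain ⟨B, hB, h⟩ := hC.2 {a, b} (by simp [insert_subset_iff, ha, hb]) (card_pair hab)
  have h' : {a, b} ∩ B = {a, b} :=
    eq_of_subset_of_card_le inter_subset_left (by rwa [card_pair hab])
  have h2 := inter_eq_left.1 h'
  exact ⟨B, hB, h2 (by simp), h2 (by simp)⟩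

/-- If the blocks of a family of partitions cover all pairs, then a triple contained in no block
has its pairs in blocks of at least three of the partitions. -/
theorem three_le_card_classes {α ι : Type*} [DecidableEq α] [Fintype ι]
    {P : ι → Finset (Finset α)} (hpart : ∀ i x, ∃! B, B ∈ P i ∧ x ∈ B)
    (hcov : ∀ a b, a ≠ b → ∃ i, ∃ B ∈ P i, a ∈ B ∧ b ∈ B) {A : Finset α} (hA : A.card = 3)
    (hnot : ∀ i, ∀ B ∈ P i, ¬ A ⊆ B) (S : Finset ι)
    (hS : ∀ i, (∃ B ∈ P i, 2 ≤ (A ∩ B).card) → i ∈ S) : 3 ≤ S.card := by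
  classical
  obtain ⟨a, b, c, hab, hac, hbc, rfl⟩ := card_eq_three.1 hA
  have two_le {x y : α} {B : Finset α} (hxy : x ≠ y) (hx : x ∈ ({a, b, c} : Finset α))
      (hy : y ∈ ({a, b, c} : Finset α)) (hxB : x ∈ B) (hyB : y ∈ B) :
      2 ≤ (({a, b, c} : Finset α) ∩ B).card := by
    rw [← card_pair hxy]
    exact card_le_card (by simp only [insert_subset_iff, singleton_subset_iff, mem_inter]; tauto)
  obtain ⟨i, B, hB, haB, hbB⟩ := hcov a b hab
  obtain ⟨j, C, hC, haC, hcC⟩ := hcov a c hac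
  obtain ⟨l, D, hD, hbD, hcD⟩ := hcov b c hbc
  have hij : i ≠ j := by
    rintro rfl
    obtain rfl := (hpart i a).unique ⟨hB, haB⟩ ⟨hC, haC⟩
    exact hnot i B hB (by simp [insert_subset_iff, *])
  have hil : i ≠ l := by
    rintro rfl
    obtain rfl := (hpart i b).unique ⟨hB, hbB⟩ ⟨hD, hbD⟩
    exact hnot i B hB (by simp [insert_subset_iff, *])
  have hjl : j ≠ l := by
    rintro rfl
    obtain rfl := (hpart j c).unique ⟨hC, hcC⟩ ⟨hD, hcD⟩
    exact hnot j C hC (by simp [insert_subset_iff, *])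
  rw [← card_eq_three.2 ⟨i, j, l, hij, hil, hjl, rfl⟩]
  refine card_le_card ?_
  simp only [insert_subset_iff, singleton_subset_iff]
  exact ⟨hS i ⟨B, hB, two_le hab (by simp) (by simp) haB hbB⟩,
    hS j ⟨C, hC, two_le hac (by simp) (by simp) haC hcC⟩,
    hS l ⟨D, hD, two_le hbc (by simp) (by simp) hbD hcD⟩⟩

/-- If at most five partitions have blocks covering all pairs, then any two triples meet two
blocks of a common partition in at least four points altogether. -/
theorem exists_blocks_four_le {α ι : Type*} [DecidableEq α] [Fintype ι]
    {P : ι → Finset (Finset α)} (hι : Fintype.card ι ≤ 5)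
    (hpart : ∀ i x, ∃! B, B ∈ P i ∧ x ∈ B)
    (hcov : ∀ a b, a ≠ b → ∃ i, ∃ B ∈ P i, a ∈ B ∧ b ∈ B) {A D : Finset α}
    (hA : A.card = 3) (hD : D.card = 3) :
    ∃ i, ∃ B ∈ P i, ∃ B' ∈ P i, 4 ≤ (A ∩ B).card + (D ∩ B').card := by
  classical
  have meets {E : Finset α} (hE : E.card = 3) (i : ι) : ∃ B ∈ P i, 1 ≤ (E ∩ B).card := by
    obtain ⟨x, hx⟩ := card_pos.1 (by omega : 0 < E.card)
    obtain ⟨B, ⟨hB, hxB⟩, _⟩ := hpart i x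
    exact ⟨B, hB, card_pos.2 ⟨x, mem_inter.2 ⟨hx, hxB⟩⟩⟩
  by_cases hA' : ∃ i, ∃ B ∈ P i, A ⊆ B
  · obtain ⟨i, B, hB, hAB⟩ := hA'
    obtain ⟨B', hB', h⟩ := meets hD i
    exact ⟨i, B, hB, B', hB', by rw [inter_eq_left.2 hAB]; omega⟩
  by_cases hD' : ∃ i, ∃ B ∈ P i, D ⊆ B
  · obtain ⟨i, B', hB', hDB⟩ := hD'
    obtain ⟨B, hB, h⟩ := meets hA i
    exact ⟨i, B, hB, B', hB', by rw [inter_eq_left.2 hDB]; omega⟩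
  push Not at hA' hD'
  let S (E : Finset α) : Finset ι := {i | ∃ B ∈ P i, 2 ≤ (E ∩ B).card}
  have hSA : 3 ≤ (S A).card :=
    three_le_card_classes hpart hcov hA hA' _ fun i hi => by simpa [S] using hi
  have hSD : 3 ≤ (S D).card :=
    three_le_card_classes hpart hcov hD hD' _ fun i hi => by simpa [S] using hi
  have hne : (S A ∩ S D).Nonempty := by
    have h1 := card_union_add_card_inter (S A) (S D)
    have h2 := card_le_univ (S A ∪ S D)
    exact card_pos.1 (by omega)
  obtain ⟨i, hi⟩ := hne
  simp only [S, mem_inter, mem_filter, mem_univ, true_and] at hi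
  obtain ⟨⟨B, hB, h1⟩, B', hB', h2⟩ := hi
  exact ⟨i, B, hB, B', hB', by omega⟩

/-- A partition of `α` into blocks of size `h` has `|α| / h` blocks. -/
theorem card_mul_eq_of_partition {α : Type*} [DecidableEq α] [Fintype α]
    {Q : Finset (Finset α)} {h : ℕ} (hcard : ∀ B ∈ Q, B.card = h)
    (hpart : ∀ x, ∃! B, B ∈ Q ∧ x ∈ B) : Q.card * h = Fintype.card α := by
  have h1 : ∑ B ∈ Q, B.card = Fintype.card α * 1 := by
    refine sum_card fun x => ?_
    obtain ⟨B, hB, huniq⟩ := hpart x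
    refine card_eq_one.2 ⟨B, ?_⟩
    ext B'
    simp only [mem_filter, mem_singleton]
    exact ⟨huniq B', fun h => h ▸ hB⟩
  rw [sum_const_nat hcard] at h1
  omega

/-- Gluing a pair of `(n, k, 4)` covers on the two halves of `2n` points with the unions of
blocks from corresponding classes gives a `(2n, k, 4, 6)` cover. -/
theorem isCover_halves {n h p : ℕ} (hp : p ≤ 5) {C : Finset (Finset (Fin n))}
    (hC : IsCover univ C (h + h) 4 4) {P : Fin p → Finset (Finset (Fin n))}
    (hcard : ∀ i, ∀ B ∈ P i, B.card = h) (hpart : ∀ i x, ∃! B, B ∈ P i ∧ x ∈ B)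
    (hcov : IsCover univ (univ.biUnion P) h 2 2) :
    IsCover univ
      ((C.image (map (Fin.castAddEmb n)) ∪ C.image (map (Fin.natAddEmb n))) ∪
        univ.biUnion fun i => (P i ×ˢ P i).image fun q =>
          q.1.map (Fin.castAddEmb n) ∪ q.2.map (Fin.natAddEmb n))
      (h + h) 4 6 := by
  have hdisj (A D : Finset (Fin n)) :
      Disjoint (A.map (Fin.castAddEmb n)) (D.map (Fin.natAddEmb n)) := by
    simp only [disjoint_left, mem_map, not_exists, not_and]
    rintro _ ⟨x, _, rfl⟩ y _ hxy
    have := congrArg Fin.val hxy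
    simp at this
    omega
  constructor
  · intro B hB
    refine ⟨subset_univ _, ?_⟩
    simp only [mem_union, mem_image, mem_biUnion, mem_univ, true_and, mem_product] at hB
    obtain (⟨B, hB, rfl⟩ | ⟨B, hB, rfl⟩) | ⟨i, ⟨B, B'⟩, ⟨hB, hB'⟩, rfl⟩ := hB
    · rw [card_map, (hC.1 B hB).2]
    · rw [card_map, (hC.1 B hB).2]
    · rw [card_union_of_disjoint (hdisj _ _), card_map, card_map, hcard i B hB, hcard i B' hB']
  · intro M _ hM
    obtain ⟨A, D, rfl⟩ : ∃ A D : Finset (Fin n),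
        M = A.map (Fin.castAddEmb n) ∪ D.map (Fin.natAddEmb n) := by
      refine ⟨univ.filter (Fin.castAdd n · ∈ M), univ.filter (Fin.natAdd n · ∈ M), ?_⟩
      ext x
      simp only [mem_union, mem_map, mem_filter, mem_univ, true_and]
      constructor
      · intro hx
        induction x using Fin.addCases with
        | left x => exact Or.inl ⟨x, hx, rfl⟩
        | right x => exact Or.inr ⟨x, hx, rfl⟩
      · rintro (⟨x, hx, rfl⟩ | ⟨x, hx, rfl⟩) <;> exact hx
    rw [card_union_of_disjoint (hdisj _ _), card_map, card_map] at hM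
    by_cases hA : 4 ≤ A.card
    · obtain ⟨B, hB, h4⟩ := hC.exists_le_card_inter (subset_univ A) hA
      refine ⟨B.map (Fin.castAddEmb n),
        mem_union_left _ (mem_union_left _ (mem_image_of_mem _ hB)), ?_⟩
      refine h4.trans ?_
      rw [← card_map (Fin.castAddEmb n), map_inter]
      exact card_le_card (inter_subset_inter_right subset_union_left)
    by_cases hD : 4 ≤ D.card
    · obtain ⟨B, hB, h4⟩ := hC.exists_le_card_inter (subset_univ D) hD
      refine ⟨B.map (Fin.natAddEmb n),
        mem_union_left _ (mem_union_right _ (mem_image_of_mem _ hB)), ?_⟩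
      refine h4.trans ?_
      rw [← card_map (Fin.natAddEmb n), map_inter]
      exact card_le_card (inter_subset_inter_right subset_union_right)
    have hpair (a b : Fin n) (hab : a ≠ b) : ∃ i, ∃ B ∈ P i, a ∈ B ∧ b ∈ B := by
      obtain ⟨B, hB, hBab⟩ := hcov.exists_mem_mem (mem_univ a) (mem_univ b) hab
      obtain ⟨i, _, hi⟩ := mem_biUnion.1 hB
      exact ⟨i, B, hi, hBab⟩
    obtain ⟨i, B, hB, B', hB', h4⟩ := exists_blocks_four_le (by simpa using hp) hpart hpair
      (by omega : A.card = 3) (by omega : D.card = 3)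
    refine ⟨B.map (Fin.castAddEmb n) ∪ B'.map (Fin.natAddEmb n), mem_union_right _
      (mem_biUnion.2 ⟨i, mem_univ _, mem_image.2 ⟨(B, B'), mem_product.2 ⟨hB, hB'⟩, rfl⟩⟩), ?_⟩
    refine h4.trans ?_
    rw [← card_map (Fin.castAddEmb n), ← card_map (s := D ∩ B') (Fin.natAddEmb n),
      ← card_union_of_disjoint (hdisj _ _), map_inter, map_inter]
    exact card_le_card (union_subset
      (inter_subset_inter subset_union_left subset_union_left)
      (inter_subset_inter subset_union_right subset_union_right))

/-- If there is a resolvable `(n,h,2)` covering design with `p ≤ 5` parallel classes,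
where `n = v/2`, `h = k/2`, `v, k` even and `n ≥ k ≥ 4`, then
`C(v,k,4,6) ≤ 2C(v/2,k,4) + pv²/k²`. -/
theorem bound_k46 (v n k h p : ℕ) (hv : Even v) (hn : n = v / 2) (hkeven : Even k)
    (hk4 : 4 ≤ k) (hkn : k ≤ n) (hh : h = k / 2) (hp : p ≤ 5)
    (hres : ∃ P : Fin p → Finset (Finset (Fin n)),
      (∀ i, ∀ B ∈ P i, (B : Finset (Fin n)).card = h) ∧
      (∀ i, ∀ x : Fin n, ∃! B, B ∈ P i ∧ x ∈ B) ∧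
      IsCover Finset.univ (Finset.univ.biUnion P) h 2 2) :
    coverNumber v k 4 6 ≤ 2 * coverNumber (v / 2) k 4 4 + p * v ^ 2 / k ^ 2 := by
  obtain ⟨w, rfl⟩ := hv
  obtain ⟨g, rfl⟩ := hkeven
  obtain rfl : n = w := by omega
  obtain rfl : h = g := by omega
  rw [← hn]
  obtain ⟨P, hcard, hpart, hcov⟩ := hres
  obtain ⟨C, hC, hCcard⟩ := exists_cover_card_eq hk4 hkn
  have hle : coverNumber (n + n) (h + h) 4 6 ≤ _ :=
    Nat.sInf_le ⟨_, isCover_halves hp hC hcard hpart hcov, rfl⟩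
  refine hle.trans ?_
  refine (card_union_le _ _).trans (Nat.add_le_add ?_ ?_)
  · have h1 := card_union_le (C.image (map (Fin.castAddEmb n))) (C.image (map (Fin.natAddEmb n)))
    have h2 := card_image_le (s := C) (f := map (Fin.castAddEmb n))
    have h3 := card_image_le (s := C) (f := map (Fin.natAddEmb n))
    omega
  · rw [Nat.le_div_iff_mul_le (by positivity)]
    calc _ ≤ (∑ i : Fin p, (P i).card * (P i).card) * (h + h) ^ 2 := by
          refine Nat.mul_le_mul_right _ (card_biUnion_le.trans (sum_le_sum fun i _ => ?_))
          exact card_image_le.trans (card_product _ _).le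
      _ = ∑ _i : Fin p, (n + n) ^ 2 := by
          rw [sum_mul]
          refine sum_congr rfl fun i _ => ?_
          have hi := card_mul_eq_of_partition (hcard i) (hpart i)
          rw [Fintype.card_fin] at hi
          linear_combination 4 * ((P i).card * h + n) * hi
      _ = p * (n + n) ^ 2 := by simp
end

section
/- For every integer k ≥ 2 with k ≡ 0 (mod 3), C(6k, 2k, 4, 6) ≤ 42. -/
open Finset

/-- The columns of the parity check matrix of a ternary `[6, 3]` code: the points other than the
intersection point on two lines of the projective plane over `ZMod 3`. -/
def parityColumn : Fin 6 → ZMod 3 × ZMod 3 × ZMod 3 :=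
  ![(1, 0, 0), (1, 0, 1), (1, 0, 2), (0, 1, 0), (0, 1, 1), (0, 1, 2)]

/-- The encoder of the ternary `[6, 3]` code with parity check columns `parityColumn`. -/
def encode (m : ZMod 3 × ZMod 3 × ZMod 3) : Fin 6 → ZMod 3 :=
  ![m.1, m.2.1, -m.1 - m.2.1, m.2.2, m.2.2 + m.1 - m.2.1, m.2.2 - m.1 + m.2.1]

/-- No line of the projective plane over `ZMod 3` is tangent to the set of parity check columns. -/
theorem exists_eq_smul_parityColumn_add (i : Fin 6) (s : ZMod 3 × ZMod 3 × ZMod 3) :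
    ∃ (j : Fin 6) (a b : ZMod 3), s = a • parityColumn i + b • parityColumn j := by
  revert i s
  decide +kernel

theorem exists_encode_eq {w : Fin 6 → ZMod 3} (hw : ∑ i, w i • parityColumn i = 0) :
    ∃ m, encode m = w := by
  refine ⟨(w 0, w 1, w 3), ?_⟩
  have h : ∀ a b c d e f : ZMod 3, a • parityColumn 0 + b • parityColumn 1 + c • parityColumn 2 +
      d • parityColumn 3 + e • parityColumn 4 + f • parityColumn 5 = 0 →
      -a - b = c ∧ d + a - b = e ∧ d - a + b = f := by
    decide +kernel
  obtain ⟨h₁, h₂, h₃⟩ := h _ _ _ _ _ _ (by simpa only [Fin.sum_univ_six] using hw)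
  ext i
  fin_cases i <;> simp [encode, h₁, h₂, h₃]

/-- Puncturing the code at any coordinate gives a code of covering radius at most one. -/
theorem exists_encode_eq_off_pair (w : Fin 6 → ZMod 3) (i : Fin 6) :
    ∃ j m, ∀ l, l ≠ i → l ≠ j → encode m l = w l := by
  obtain ⟨j, a, b, hs⟩ := exists_eq_smul_parityColumn_add i (∑ l, w l • parityColumn l)
  obtain ⟨m, hm⟩ := exists_encode_eq (w := w - Pi.single i a - Pi.single j b) (by
    simp only [Pi.sub_apply, sub_smul, sum_sub_distrib, hs, Pi.single_apply, ite_smul, zero_smul,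
      sum_ite_eq', mem_univ, if_true]
    abel)
  refine ⟨j, m, fun l hi hj => ?_⟩
  simp [hm, hi, hj]

/-- The `42` blocks on the points `Fin 6 × ZMod 3`: unions of two rows, and codewords. -/
def baseBlocks : Finset (Finset (Fin 6 × ZMod 3)) :=
  (univ.filter fun p : Fin 6 × Fin 6 => p.1 < p.2).image (fun p => {p.1, p.2} ×ˢ univ) ∪
    univ.image fun m => univ.image fun i => (i, encode m i)

theorem card_baseBlocks_le : baseBlocks.card ≤ 42 := by
  refine (card_union_le _ _).trans (Nat.add_le_add (b := 15) (d := 27) ?_ ?_)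
  · exact card_image_le.trans (by decide)
  · exact card_image_le.trans (by simp [ZMod.card])

theorem card_of_mem_baseBlocks {S : Finset (Fin 6 × ZMod 3)} (hS : S ∈ baseBlocks) :
    S.card = 6 := by
  simp only [baseBlocks, mem_union, mem_image, mem_filter, mem_univ, true_and] at hS
  rcases hS with ⟨p, hp, rfl⟩ | ⟨m, rfl⟩
  · simp [card_product, card_pair hp.ne, ZMod.card]
  · rw [card_image_of_injective _ fun i j h => congrArg Prod.fst h]
    simp

theorem exists_forall_ne_pos {n : Fin 6 → ℕ} (hsum : ∑ i, n i = 6)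
    (hn : ∀ i j, i < j → n i + n j < 4) : ∃ i, ∀ l, l ≠ i → 0 < n l := by
  have key : ∀ i j, i < j → n i = 0 → n j = 0 → False := by
    rw [Fin.sum_univ_six] at hsum
    have h01 := hn 0 1 (by decide)
    have h02 := hn 0 2 (by decide)
    have h03 := hn 0 3 (by decide)
    have h04 := hn 0 4 (by decide)
    have h05 := hn 0 5 (by decide)
    have h12 := hn 1 2 (by decide)
    have h13 := hn 1 3 (by decide)
    have h14 := hn 1 4 (by decide)
    have h15 := hn 1 5 (by decide)
    have h23 := hn 2 3 (by decide)
    have h24 := hn 2 4 (by decide)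
    have h25 := hn 2 5 (by decide)
    have h34 := hn 3 4 (by decide)
    have h35 := hn 3 5 (by decide)
    have h45 := hn 4 5 (by decide)
    intro i j hij hi hj
    fin_cases i <;> fin_cases j <;> simp at hij hi hj <;> omega
  by_cases h : ∃ i, n i = 0
  · obtain ⟨i, hi⟩ := h
    refine ⟨i, fun l hl => Nat.pos_of_ne_zero fun h0 => ?_⟩
    rcases lt_or_gt_of_ne hl with h | h
    · exact key l i h h0 hi
    · exact key i l h hi h0
  · exact ⟨0, fun l _ => Nat.pos_of_ne_zero fun h0 => h ⟨l, h0⟩⟩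

/-- Six points labelled by `Fin 6 × ZMod 3`, with repetition, meet some base block in at least
four points. -/
theorem exists_mem_baseBlocks {α : Type*} (f : α → Fin 6 × ZMod 3) (M : Finset α)
    (hM : M.card = 6) : ∃ S ∈ baseBlocks, 4 ≤ (M.filter fun x => f x ∈ S).card := by
  classical
  by_cases hpair : ∃ i j : Fin 6, i < j ∧
      4 ≤ (M.filter fun x => (f x).1 = i).card + (M.filter fun x => (f x).1 = j).card
  · obtain ⟨i, j, hij, h⟩ := hpair
    refine ⟨{i, j} ×ˢ univ, mem_union_left _ (mem_image.2 ⟨(i, j), by simpa using hij, rfl⟩), ?_⟩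
    rw [← card_union_of_disjoint
      (disjoint_filter.2 fun x _ hi hj => hij.ne (hi.symm.trans hj)), ← filter_or] at h
    simpa using h
  · push Not at hpair
    obtain ⟨i, hi⟩ := exists_forall_ne_pos
      (n := fun i => (M.filter fun x => (f x).1 = i).card)
      ((card_eq_sum_card_fiberwise fun _ _ => mem_coe.2 (mem_univ _)).symm.trans hM)
      hpair
    have hp : ∀ l, ∃ x, l ≠ i → x ∈ M ∧ (f x).1 = l := by
      intro l
      by_cases hl : l = i
      · obtain ⟨x, -⟩ := card_pos.1 (hM ▸ Nat.succ_pos 5 : 0 < M.card)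
        exact ⟨x, fun h => absurd hl h⟩
      · obtain ⟨x, hx⟩ := card_pos.1 (hi l hl)
        exact ⟨x, fun _ => mem_filter.1 hx⟩
    choose p hp using hp
    obtain ⟨j, m, hm⟩ := exists_encode_eq_off_pair (fun l => (f (p l)).2) i
    refine ⟨univ.image fun l => (l, encode m l),
      mem_union_right _ (mem_image_of_mem _ (mem_univ m)), ?_⟩
    calc 4 ≤ (univ \ {i, j} : Finset (Fin 6)).card := by
          have h₁ := le_card_sdiff {i, j} (univ : Finset (Fin 6))
          have h₂ := card_le_two (a := i) (b := j)
          rw [card_univ, Fintype.card_fin] at h₁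
          omega
      _ ≤ _ := by
        refine card_le_card_of_injOn p (fun l hl => ?_) fun l hl l' hl' h => ?_
        · simp only [coe_sdiff, Set.mem_sdiff, mem_coe, mem_univ, true_and, mem_insert,
            mem_singleton, not_or] at hl
          obtain ⟨hM', hl'⟩ := hp l hl.1
          refine mem_coe.2 (mem_filter.2 ⟨hM', mem_image.2 ⟨l, mem_univ _, ?_⟩⟩)
          exact Prod.ext hl'.symm (hm l hl.1 hl.2)
        · simp only [coe_sdiff, Set.mem_sdiff, mem_coe, mem_univ, true_and, mem_insert,
            mem_singleton, not_or] at hl hl'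
          rw [← (hp l hl.1).2, ← (hp l' hl'.1).2, h]

theorem IsCover.coverNumber_le_card {v k t m : ℕ} {Bs : Finset (Finset (Fin v))}
    (h : IsCover univ Bs k t m) : coverNumber v k t m ≤ Bs.card := by
  unfold coverNumber
  exact Nat.sInf_le ⟨Bs, h, rfl⟩

/-- For every integer `k ≥ 2` with `k ≡ 0 (mod 3)`, `C(6k, 2k, 4, 6) ≤ 42`. -/
theorem bound_6k_2k_46_mod0 (k : ℕ) (hk : 2 ≤ k) (hk3 : k % 3 = 0) :
    coverNumber (6 * k) (2 * k) 4 6 ≤ 42 := by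
  obtain ⟨q, rfl⟩ := Nat.dvd_of_mod_eq_zero hk3
  let e : Fin (6 * (3 * q)) ≃ (Fin 6 × ZMod 3) × Fin q :=
    Fintype.equivOfCardEq (by simp [ZMod.card]; ring)
  let blowUp (S : Finset (Fin 6 × ZMod 3)) : Finset (Fin (6 * (3 * q))) :=
    (S ×ˢ univ).map e.symm.toEmbedding
  have mem_blowUp (S : Finset (Fin 6 × ZMod 3)) (x : Fin (6 * (3 * q))) :
      x ∈ blowUp S ↔ (e x).1 ∈ S := by
    simp [blowUp, mem_map_equiv]
  suffices h : IsCover univ (baseBlocks.image blowUp) (2 * (3 * q)) 4 6 from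
    h.coverNumber_le_card.trans (card_image_le.trans card_baseBlocks_le)
  refine ⟨fun B hB => ⟨subset_univ _, ?_⟩, fun M _ hM => ?_⟩
  · obtain ⟨S, hS, rfl⟩ := mem_image.1 hB
    simp only [blowUp, card_map, card_product, card_of_mem_baseBlocks hS, card_univ,
      Fintype.card_fin]
    ring
  · obtain ⟨S, hS, h⟩ := exists_mem_baseBlocks (fun x => (e x).1) M hM
    refine ⟨blowUp S, mem_image_of_mem _ hS, h.trans (card_le_card fun x hx => ?_)⟩
    rw [mem_filter] at hx
    exact mem_inter.2 ⟨hx.1, (mem_blowUp S x).2 hx.2⟩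
end

section
/- Let X be a set of v elements partitioned into 4 quasi-equal parts X₀, X₁, X₂, X₃ of sizes v₀, v₁, v₂, v₃ ≥ 5, and let h be a positive integer. For 0 ≤ i ≤ 3 and 1 ≤ j ≤ h, let (X_i, A_{i,j}) be a (v_i, 3, 2) covering design and (X_i, B_{i,j}) be a (v_i, 2, 1) covering design, such that for each i the union A_{i,1} ∪ ⋯ ∪ A_{i,h} equals the set of all 3-subsets of X_i and B_{i,1} ∪ ⋯ ∪ B_{i,h} equals the set of all 2-subsets of X_i. For i = 0, 1, let (X_i, D_i) be a (v_i, 5, 4, 5) cover, and for i = 2, 3 let (X_i, E_i) be a (v_i, 5, 4) covering design. Define C = ⋃_{i=0}^{1} (D_i ∪ E_{i+2}) ∪ ⋃_{i=0}^{3} ⋃_{j=1}^{h} { A ∪ B : A ∈ A_{i,j}, B ∈ B_{(i+1) mod 4, j} } ∪ ⋃_{i=0}^{1} ⋃_{j=1}^{h} { A ∪ B : A ∈ A_{i,j}, B ∈ B_{i+2, j} }. Then (X, C) is a (v, 5, 4, 6) cover. -/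
theorem IsCover.exists_le_card_inter_s18 {α : Type*} [DecidableEq α] {P : Finset α}
    {Bs : Finset (Finset α)} {k t m : ℕ} (hBs : IsCover P Bs k t m) {M : Finset α}
    (hM : m ≤ (M ∩ P).card) : ∃ b ∈ Bs, t ≤ (M ∩ b).card := by
  obtain ⟨S, hS, hcard⟩ := Finset.exists_subset_card_eq hM
  obtain ⟨b, hb, ht⟩ := hBs.2 S (hS.trans Finset.inter_subset_right) hcard
  exact ⟨b, hb, ht.trans (Finset.card_le_card
    (Finset.inter_subset_inter_right (hS.trans Finset.inter_subset_left)))⟩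

theorem exists_mem_le_card_inter_of_biUnion_eq_powersetCard {α : Type*} [DecidableEq α]
    {P : Finset α} {h k : ℕ} {F : ℕ → Finset (Finset α)}
    (hF : (Finset.range h).biUnion F = P.powersetCard k) {M : Finset α}
    (hM : k ≤ (M ∩ P).card) : ∃ j < h, ∃ s ∈ F j, k ≤ (M ∩ s).card := by
  obtain ⟨S, hS, hcard⟩ := Finset.exists_subset_card_eq hM
  have hmem : S ∈ (Finset.range h).biUnion F := by
    rw [hF, Finset.mem_powersetCard]
    exact ⟨hS.trans Finset.inter_subset_right, hcard⟩
  obtain ⟨j, hj, hSj⟩ := Finset.mem_biUnion.1 hmem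
  refine ⟨j, Finset.mem_range.1 hj, S, hSj, ?_⟩
  rw [Finset.inter_eq_right.2 (hS.trans Finset.inter_subset_left), hcard]

theorem card_inter_union_of_subset_of_disjoint {α : Type*} [DecidableEq α]
    {P Q a b : Finset α} (M : Finset α) (hPQ : Disjoint P Q) (ha : a ⊆ P) (hb : b ⊆ Q) :
    (M ∩ (a ∪ b)).card = (M ∩ a).card + (M ∩ b).card := by
  rw [Finset.inter_union_distrib_left, Finset.card_union_of_disjoint]
  exact (hPQ.mono ha hb).mono Finset.inter_subset_right Finset.inter_subset_right

/-- The unions of blocks from equally indexed families meet a set in four points as soon as it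
has two points in each part, or three points in the first part and one in the second. -/
theorem exists_union_four_le_card_inter {α : Type*} [DecidableEq α] {P Q : Finset α} {h : ℕ}
    {F G : ℕ → Finset (Finset α)} (hPQ : Disjoint P Q)
    (hF : ∀ j < h, IsCover P (F j) 3 2 2) (hG : ∀ j < h, IsCover Q (G j) 2 1 1)
    (hFall : (Finset.range h).biUnion F = P.powersetCard 3)
    (hGall : (Finset.range h).biUnion G = Q.powersetCard 2) {M : Finset α}
    (hM : 2 ≤ (M ∩ P).card ∧ 2 ≤ (M ∩ Q).card ∨ 3 ≤ (M ∩ P).card ∧ 1 ≤ (M ∩ Q).card) :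
    ∃ j < h, ∃ a ∈ F j, ∃ b ∈ G j, 4 ≤ (M ∩ (a ∪ b)).card := by
  rcases hM with ⟨hP, hQ⟩ | ⟨hP, hQ⟩
  · obtain ⟨j, hj, b, hb, hbM⟩ := exists_mem_le_card_inter_of_biUnion_eq_powersetCard hGall hQ
    obtain ⟨a, ha, haM⟩ := (hF j hj).exists_le_card_inter_s18 hP
    refine ⟨j, hj, a, ha, b, hb, ?_⟩
    rw [card_inter_union_of_subset_of_disjoint M hPQ ((hF j hj).1 a ha).1 ((hG j hj).1 b hb).1]
    omega
  · obtain ⟨j, hj, a, ha, haM⟩ := exists_mem_le_card_inter_of_biUnion_eq_powersetCard hFall hP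
    obtain ⟨b, hb, hbM⟩ := (hG j hj).exists_le_card_inter_s18 hQ
    refine ⟨j, hj, a, ha, b, hb, ?_⟩
    rw [card_inter_union_of_subset_of_disjoint M hPQ ((hF j hj).1 a ha).1 ((hG j hj).1 b hb).1]
    omega

/-- Construction of `(v,5,4,6)` covers: partition `X` into 4 quasi-equal parts of sizes ≥ 5;
take for each part `h` many `(vᵢ,3,2)` covering designs `A i j` (jointly exhausting all
3-subsets) and `(vᵢ,2,1)` covering designs `B i j` (jointly exhausting all 2-subsets),
`(vᵢ,5,4,5)` covers `D₀, D₁` on parts 0, 1 and `(vᵢ,5,4)` covering designs `E₂, E₃` on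
parts 2, 3.  Then `⋃ᵢ(Dᵢ ∪ E_{i+2}) ∪ ⋃ᵢⱼ A_{i,j}B_{(i+1) mod 4, j} ∪
⋃_{i≤1}⋃ⱼ A_{i,j}B_{i+2, j}` is a `(v,5,4,6)` cover. -/
theorem constr_546 {α : Type*} [DecidableEq α]
    (v h : ℕ) (hh : 0 < h)
    (X : Finset α) (hX : X.card = v)
    (parts : Fin 4 → Finset α)
    (hdisj : ∀ i j, i ≠ j → Disjoint (parts i) (parts j))
    (hunion : Finset.univ.biUnion parts = X)
    (hquasi : ∀ i j, (parts i).card ≤ (parts j).card + 1)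
    (hsize : ∀ i, 5 ≤ (parts i).card)
    (A B : Fin 4 → ℕ → Finset (Finset α))
    (hA : ∀ i, ∀ j < h, IsCover (parts i) (A i j) 3 2 2)
    (hB : ∀ i, ∀ j < h, IsCover (parts i) (B i j) 2 1 1)
    (hAall : ∀ i, (Finset.range h).biUnion (A i) = (parts i).powersetCard 3)
    (hBall : ∀ i, (Finset.range h).biUnion (B i) = (parts i).powersetCard 2)
    (D0 D1 E2 E3 : Finset (Finset α))
    (hD0 : IsCover (parts 0) D0 5 4 5) (hD1 : IsCover (parts 1) D1 5 4 5)
    (hE2 : IsCover (parts 2) E2 5 4 4) (hE3 : IsCover (parts 3) E3 5 4 4) :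
    IsCover X
      (D0 ∪ D1 ∪ E2 ∪ E3 ∪
        (Finset.univ.biUnion fun i : Fin 4 =>
          (Finset.range h).biUnion fun j =>
            (A i j).biUnion fun a => (B (i + 1) j).image fun b => a ∪ b) ∪
        (({0, 1} : Finset (Fin 4)).biUnion fun i =>
          (Finset.range h).biUnion fun j =>
            (A i j).biUnion fun a => (B (i + 2) j).image fun b => a ∪ b))
      5 4 6 := by
  have hsub : ∀ i, parts i ⊆ X := fun i => by
    rw [← hunion]
    exact Finset.subset_biUnion_of_mem parts (Finset.mem_univ i)
  have hblock : ∀ i k, i ≠ k → ∀ j < h, ∀ a ∈ A i j, ∀ b ∈ B k j,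
      a ∪ b ⊆ X ∧ (a ∪ b).card = 5 := by
    intro i k hik j hj a ha b hb
    obtain ⟨haP, hac⟩ := (hA i j hj).1 a ha
    obtain ⟨hbP, hbc⟩ := (hB k j hj).1 b hb
    refine ⟨Finset.union_subset (haP.trans (hsub i)) (hbP.trans (hsub k)), ?_⟩
    rw [Finset.card_union_of_disjoint ((hdisj i k hik).mono haP hbP), hac, hbc]
  refine ⟨fun b hb => ?_, fun M hMX hM => ?_⟩
  · simp only [Finset.mem_union, Finset.mem_biUnion, Finset.mem_image, Finset.mem_range] at hb
    rcases hb with ((((hb | hb) | hb) | hb) | ⟨i, -, j, hj, a, ha, c, hc, rfl⟩) |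
      ⟨i, -, j, hj, a, ha, c, hc, rfl⟩
    · exact ⟨(hD0.1 b hb).1.trans (hsub 0), (hD0.1 b hb).2⟩
    · exact ⟨(hD1.1 b hb).1.trans (hsub 1), (hD1.1 b hb).2⟩
    · exact ⟨(hE2.1 b hb).1.trans (hsub 2), (hE2.1 b hb).2⟩
    · exact ⟨(hE3.1 b hb).1.trans (hsub 3), (hE3.1 b hb).2⟩
    · exact hblock i (i + 1) (by clear ha hc; decide +revert) j hj a ha c hc
    · exact hblock i (i + 2) (by clear ha hc; decide +revert) j hj a ha c hc
  · have hsum : (M ∩ parts 0).card + (M ∩ parts 1).card + (M ∩ parts 2).card +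
        (M ∩ parts 3).card = 6 := by
      rw [← hM, ← Fin.sum_univ_four fun i => (M ∩ parts i).card, ← Finset.card_biUnion,
        ← Finset.inter_biUnion, hunion, Finset.inter_eq_left.2 hMX]
      exact fun i _ j _ hij =>
        (hdisj i j hij).mono Finset.inter_subset_right Finset.inter_subset_right
    by_contra! hcon
    simp only [Finset.mem_union, Finset.mem_biUnion, Finset.mem_image, Finset.mem_range] at hcon
    have hjoin : ∀ i k, i ≠ k → (k = i + 1 ∨ i ∈ ({0, 1} : Finset (Fin 4)) ∧ k = i + 2) →
        ¬(2 ≤ (M ∩ parts i).card ∧ 2 ≤ (M ∩ parts k).card ∨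
          3 ≤ (M ∩ parts i).card ∧ 1 ≤ (M ∩ parts k).card) := by
      intro i k hik hk hMik
      obtain ⟨j, hj, a, ha, b, hb, hab⟩ := exists_union_four_le_card_inter (hdisj i k hik)
        (hA i) (hB k) (hAall i) (hBall k) hMik
      refine (hcon (a ∪ b) ?_).not_ge hab
      rcases hk with rfl | ⟨hi, rfl⟩
      · exact .inl (.inr ⟨i, Finset.mem_univ i, j, hj, a, ha, b, hb, rfl⟩)
      · exact .inr ⟨i, hi, j, hj, a, ha, b, hb, rfl⟩
    have h0 : ¬5 ≤ (M ∩ parts 0).card := fun hle => by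
      obtain ⟨b, hb, hbM⟩ := hD0.exists_le_card_inter_s18 hle
      exact (hcon b (by simp [hb])).not_ge hbM
    have h1 : ¬5 ≤ (M ∩ parts 1).card := fun hle => by
      obtain ⟨b, hb, hbM⟩ := hD1.exists_le_card_inter_s18 hle
      exact (hcon b (by simp [hb])).not_ge hbM
    have h2 : ¬4 ≤ (M ∩ parts 2).card := fun hle => by
      obtain ⟨b, hb, hbM⟩ := hE2.exists_le_card_inter_s18 hle
      exact (hcon b (by simp [hb])).not_ge hbM
    have h3 : ¬4 ≤ (M ∩ parts 3).card := fun hle => by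
      obtain ⟨b, hb, hbM⟩ := hE3.exists_le_card_inter_s18 hle
      exact (hcon b (by simp [hb])).not_ge hbM
    have h01 := hjoin 0 1 (by decide) (by decide)
    have h12 := hjoin 1 2 (by decide) (by decide)
    have h23 := hjoin 2 3 (by decide) (by decide)
    have h30 := hjoin 3 0 (by decide) (by decide)
    have h02 := hjoin 0 2 (by decide) (by decide)
    have h13 := hjoin 1 3 (by decide) (by decide)
    omega
end
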